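/- Let (X,d) be a complete, separable, geodesic metric space and p > 1. Let M₀, M₁ ∈ P_p(P_p(X)) and let 𝔓 ∈ P(P(X × X)) be an optimal random coupling, i.e., its marginals under π ↦ p¹_♯π and π ↦ p²_♯π are M₀ and M₁ respectively, and ∫∫ d^p(x,y) dπ(x,y) d𝔓(π) = 𝒲_p^p(M₀,M₁), where 𝒲_p is the Wasserstein-on-Wasserstein distance. Let geo_t : X × X → X be a Borel selection of constant-speed geodesics evaluated at time t. Then the curve M_t^𝔓 := ((geo_t)_♯)_♯ 𝔓 is a constant-speed geodesic in (P_p(P_p(X)), 𝒲_p) connecting M₀ and M₁. -/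

import Mathlib

open MeasureTheory Set ENNReal

noncomputable section

/-- The set of couplings between two measures. -/
def couplings {α : Type*} [MeasurableSpace α] (μ ν : Measure α) : Set (Measure (α × α)) :=
  {π | π.map Prod.fst = μ ∧ π.map Prod.snd = ν}

/-- The `p`-th power of the `p`-Wasserstein distance on `P(X)` built from a cost
`c : X × X → ℝ≥0∞` (take `c z = edist z.1 z.2 ^ p`). -/
def Wcost {α : Type*} [MeasurableSpace α] (c : α × α → ℝ≥0∞) (μ ν : Measure α) : ℝ≥0∞ :=
  ⨅ π ∈ couplings μ ν, ∫⁻ z, c z ∂π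

/-- The `p`-th power of the `p`-Wasserstein distance. -/
def Wpp {α : Type*} [MeasurableSpace α] [PseudoEMetricSpace α] (p : ℝ)
    (μ ν : Measure α) : ℝ≥0∞ :=
  Wcost (fun z => edist z.1 z.2 ^ p) μ ν

/-- The `p`-th power of the Wasserstein-on-Wasserstein distance `𝒲_p` on `P(P(X))`:
`𝒲_p^p(M,N) = inf { ∫ W_p^p(μ,ν) dΠ : Π coupling of M, N }`. -/
def WWpp {α : Type*} [MeasurableSpace α] [PseudoEMetricSpace α] (p : ℝ)
    (M N : Measure (Measure α)) : ℝ≥0∞ :=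
  Wcost (fun q => Wpp p q.1 q.2) M N

namespace MeasureTheory.ProbabilityMeasure

open Filter Topology

/-- Finite intersections of a countable generating family of measurable sets. -/
def generatingInter (α : Type*) [MeasurableSpace α] [MeasurableSpace.CountablyGenerated α]
    (F : Finset ℕ) : Set α :=
  ⋂ n ∈ F, MeasurableSpace.natGeneratingSequence α n

/-- The masses of a probability measure on a countable generating `π`-system. -/
def masses {α : Type*} [MeasurableSpace α] [MeasurableSpace.CountablyGenerated α]
    (μ : ProbabilityMeasure α) (F : Finset ℕ) : ℝ≥0∞ :=
  (μ : Measure α) (generatingInter α F)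

section CountablyGenerated

variable {α : Type*} [MeasurableSpace α] [MeasurableSpace.CountablyGenerated α]

lemma measurableSet_generatingInter (F : Finset ℕ) : MeasurableSet (generatingInter α F) :=
  F.measurableSet_biInter fun _ _ => MeasurableSpace.measurableSet_natGeneratingSequence _

lemma isPiSystem_range_generatingInter : IsPiSystem (range (generatingInter α)) := by
  rintro _ ⟨F, rfl⟩ _ ⟨G, rfl⟩ -
  exact ⟨F ∪ G, by simp only [generatingInter, Finset.mem_union, iInter_or, iInter_inter_distrib]⟩

lemma generateFrom_range_generatingInter :
    ‹MeasurableSpace α› = MeasurableSpace.generateFrom (range (generatingInter α)) := by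
  apply le_antisymm
  · conv_lhs => rw [← MeasurableSpace.generateFrom_natGeneratingSequence α]
    refine MeasurableSpace.generateFrom_mono ?_
    rintro _ ⟨n, rfl⟩
    exact ⟨{n}, by simp [generatingInter]⟩
  · refine MeasurableSpace.generateFrom_le ?_
    rintro _ ⟨F, rfl⟩
    exact measurableSet_generatingInter F

lemma measurable_masses : Measurable (masses : ProbabilityMeasure α → Finset ℕ → ℝ≥0∞) :=
  measurable_pi_lambda _ fun F =>
    (Measure.measurable_coe (measurableSet_generatingInter F)).comp measurable_subtype_coe

lemma masses_injective :
    Function.Injective (masses : ProbabilityMeasure α → Finset ℕ → ℝ≥0∞) := by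
  intro μ ν h
  apply Subtype.ext
  have hμ : IsProbabilityMeasure (μ : Measure α) := μ.2
  have hν : IsProbabilityMeasure (ν : Measure α) := ν.2
  change (μ : Measure α) = (ν : Measure α)
  refine ext_of_generate_finite _ generateFrom_range_generatingInter
    isPiSystem_range_generatingInter ?_ (by rw [measure_univ, measure_univ])
  rintro _ ⟨F, rfl⟩
  exact congrFun h F

end CountablyGenerated

section Compact

lemma measurable_toMeasure_borel {K : Type*} [TopologicalSpace K] [HasOuterApproxClosed K]
    [MeasurableSpace K] [BorelSpace K] :
    Measurable[borel (ProbabilityMeasure K)]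
      (fun μ : ProbabilityMeasure K => (μ : Measure K)) := by
  let : MeasurableSpace (ProbabilityMeasure K) := borel _
  have : BorelSpace (ProbabilityMeasure K) := ⟨rfl⟩
  refine Measurable.measure_of_isPiSystem_of_isProbabilityMeasure
    ((BorelSpace.measurable_eq (α := K)).trans borel_eq_generateFrom_isClosed)
    isPiSystem_isClosed fun F (hF : IsClosed F) => ?_
  refine measurable_of_tendsto_metrizable
    (f := fun n (μ : ProbabilityMeasure K) => ∫⁻ x, hF.apprSeq n x ∂(μ : Measure K))
    (fun n => (continuous_lintegral_boundedContinuousFunction _).measurable) ?_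
  exact tendsto_pi_nhds.2 fun μ => HasOuterApproxClosed.tendsto_lintegral_apprSeq hF _

variable {K : Type*} [TopologicalSpace K] [CompactSpace K] [TopologicalSpace.MetrizableSpace K]
  [MeasurableSpace K] [BorelSpace K]

instance borelSpace_of_compactSpace : BorelSpace (ProbabilityMeasure K) := by
  have hle : (inferInstance : MeasurableSpace (ProbabilityMeasure K)) ≤ borel _ :=
    (measurable_toMeasure_borel (K := K)).subtype_mk (h := fun μ => μ.2) |>.le_map
  refine ⟨le_antisymm hle fun s hs => ?_⟩
  have hemb : @MeasurableEmbedding _ _ (borel (ProbabilityMeasure K)) _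
      (masses : ProbabilityMeasure K → Finset ℕ → ℝ≥0∞) := by
    let := TopologicalSpace.metrizableSpaceMetric (ProbabilityMeasure K)
    have : @StandardBorelSpace (ProbabilityMeasure K) (borel _) :=
      @StandardBorelSpace.mk _ (borel _)
        ⟨inferInstance, @BorelSpace.mk _ _ (borel _) rfl, inferInstance⟩
    exact @Measurable.measurableEmbedding _ _ _ _ _ (borel (ProbabilityMeasure K)) this
      (measurable_masses.mono hle le_rfl) masses_injective
  rw [← masses_injective.preimage_image s]
  exact measurable_masses (@MeasurableEmbedding.measurableSet_image' _ _ (borel _) _ _ hemb _ hs)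

instance standardBorelSpace_of_compactSpace : StandardBorelSpace (ProbabilityMeasure K) := by
  let := TopologicalSpace.metrizableSpaceMetric (ProbabilityMeasure K)
  infer_instance

end Compact

/-- Push-forward along a measurable map. -/
def pushforward {α β : Type*} [MeasurableSpace α] [MeasurableSpace β] {f : α → β}
    (hf : Measurable f) (μ : ProbabilityMeasure α) : ProbabilityMeasure β :=
  μ.map hf.aemeasurable

lemma coe_pushforward {α β : Type*} [MeasurableSpace α] [MeasurableSpace β] {f : α → β}
    (hf : Measurable f) (μ : ProbabilityMeasure α) :
    (pushforward hf μ : Measure β) = (μ : Measure α).map f := rfl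

lemma measurable_pushforward {α β : Type*} [MeasurableSpace α] [MeasurableSpace β] {f : α → β}
    (hf : Measurable f) : Measurable (pushforward hf) :=
  ((Measure.measurable_map f hf).comp measurable_subtype_coe).subtype_mk

lemma measurableEmbedding_pushforward {α β : Type*} [MeasurableSpace α] [MeasurableSpace β]
    {f : α → β} (hf : MeasurableEmbedding f) :
    MeasurableEmbedding (pushforward hf.measurable) := by
  have hR : MeasurableSet {ν : ProbabilityMeasure β | (ν : Measure β) (range f) = 1} :=
    ((Measure.measurable_coe hf.measurableSet_range).comp measurable_subtype_coe)
      (measurableSet_singleton 1)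
  have hinj : Function.Injective (pushforward hf.measurable) := by
    intro μ ν h
    apply Subtype.ext
    have := congrArg (fun ρ : ProbabilityMeasure β => (ρ : Measure β).comap f) h
    simp only [coe_pushforward, hf.comap_map] at this
    exact this
  refine ⟨hinj, measurable_pushforward _, fun {s} hs => ?_⟩
  have hcomap : Measurable fun ν : ProbabilityMeasure β => (ν : Measure β).comap f := by
    refine Measure.measurable_of_measurable_coe _ fun t ht => ?_
    simp_rw [hf.comap_apply]
    exact (Measure.measurable_coe (hf.measurableSet_image.2 ht)).comp measurable_subtype_coe
  have himage : pushforward hf.measurable '' s =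
      {ν : ProbabilityMeasure β | (ν : Measure β) (range f) = 1} ∩
        (fun ν : ProbabilityMeasure β => (ν : Measure β).comap f) ⁻¹'
          ((fun μ : ProbabilityMeasure α => (μ : Measure α)) '' s) := by
    ext ν
    constructor
    · rintro ⟨μ, hμ, rfl⟩
      refine ⟨?_, μ, hμ, ?_⟩
      · simp [coe_pushforward, hf.map_apply]
      · simp only [coe_pushforward, hf.comap_map]
    · rintro ⟨hν, μ, hμ, h⟩
      refine ⟨μ, hμ, Subtype.ext ?_⟩
      have h' : (μ : Measure α).map f = ((ν : Measure β).comap f).map f :=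
        congrArg (Measure.map f) h
      refine h'.trans ?_
      rw [hf.map_comap, Measure.restrict_eq_self_of_ae_mem]
      · rfl
      · exact (prob_compl_eq_zero_iff hf.measurableSet_range).2 hν
  rw [himage]
  exact hR.inter (hcomap ((MeasurableEmbedding.subtype_coe
    measurableSet_isProbabilityMeasure).measurableSet_image.2 hs))

end MeasureTheory.ProbabilityMeasure

section Wcost

variable {α β : Type*} [MeasurableSpace α] [MeasurableSpace β]

lemma Wcost_le_lintegral {c : α × α → ℝ≥0∞} {μ ν : Measure α} {π : Measure (α × α)}
    (hπ : π ∈ couplings μ ν) : Wcost c μ ν ≤ ∫⁻ z, c z ∂π :=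
  iInf₂_le π hπ

lemma isProbabilityMeasure_of_mem_couplings {μ ν : Measure α} [IsProbabilityMeasure μ]
    {π : Measure (α × α)} (hπ : π ∈ couplings μ ν) : IsProbabilityMeasure π := by
  have : IsProbabilityMeasure (π.map Prod.fst) := hπ.1 ▸ ‹_›
  exact Measure.isProbabilityMeasure_of_map Prod.fst

lemma map_swap_mem_couplings {μ ν : Measure α} {π : Measure (α × α)} (hπ : π ∈ couplings μ ν) :
    π.map Prod.swap ∈ couplings ν μ := by
  constructor
  · rw [Measure.map_map measurable_fst measurable_swap]
    exact hπ.2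
  · rw [Measure.map_map measurable_snd measurable_swap]
    exact hπ.1

lemma Wcost_comm {c : α × α → ℝ≥0∞} (hc : ∀ z, c z.swap = c z) (μ ν : Measure α) :
    Wcost c μ ν = Wcost c ν μ := by
  have key : ∀ μ ν : Measure α, Wcost c μ ν ≤ Wcost c ν μ := fun μ ν =>
    le_iInf₂ fun π hπ => by
      refine (Wcost_le_lintegral (map_swap_mem_couplings hπ)).trans ?_
      refine (lintegral_map_le _ _).trans_eq ?_
      simp only [hc]
  exact le_antisymm (key μ ν) (key ν μ)

/-- Transport costs are invariant under measurable embeddings. -/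
lemma Wcost_map {f : α → β} (hf : MeasurableEmbedding f) (c : β × β → ℝ≥0∞) (μ ν : Measure α) :
    Wcost c (μ.map f) (ν.map f) = Wcost (fun z => c (f z.1, f z.2)) μ ν := by
  have hff : MeasurableEmbedding (Prod.map f f) := hf.prodMap hf
  apply le_antisymm
  · refine le_iInf₂ fun π hπ => ?_
    refine (Wcost_le_lintegral (π := π.map (Prod.map f f)) ⟨?_, ?_⟩).trans
      (lintegral_map_le _ _)
    · rw [← hπ.1, Measure.map_map measurable_fst hff.measurable,
        Measure.map_map hf.measurable measurable_fst]
      rfl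
    · rw [← hπ.2, Measure.map_map measurable_snd hff.measurable,
        Measure.map_map hf.measurable measurable_snd]
      rfl
  · refine le_iInf₂ fun π hπ => ?_
    have hrange : ∀ᵐ y ∂π, y ∈ range (Prod.map f f) := by
      have h₁ : ∀ᵐ y ∂π, y.1 ∈ range f := by
        refine ae_of_ae_map measurable_fst.aemeasurable (p := (· ∈ range f)) ?_
        rw [hπ.1]
        exact (ae_map_iff hf.measurable.aemeasurable hf.measurableSet_range).2
          (ae_of_all _ mem_range_self)
      have h₂ : ∀ᵐ y ∂π, y.2 ∈ range f := by
        refine ae_of_ae_map measurable_snd.aemeasurable (p := (· ∈ range f)) ?_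
        rw [hπ.2]
        exact (ae_map_iff hf.measurable.aemeasurable hf.measurableSet_range).2
          (ae_of_all _ mem_range_self)
      filter_upwards [h₁, h₂] with y hy₁ hy₂
      rw [range_prodMap]
      exact ⟨hy₁, hy₂⟩
    have hmap : (π.comap (Prod.map f f)).map (Prod.map f f) = π := by
      rw [hff.map_comap, Measure.restrict_eq_self_of_ae_mem hrange]
    have hmem : π.comap (Prod.map f f) ∈ couplings μ ν := by
      constructor
      · have h := hπ.1
        rw [← hmap, Measure.map_map measurable_fst hff.measurable] at h
        have h' : ((π.comap (Prod.map f f)).map Prod.fst).map f = μ.map f := by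
          rw [← h, Measure.map_map hf.measurable measurable_fst]
          rfl
        simpa only [hf.comap_map] using congrArg (Measure.comap f) h'
      · have h := hπ.2
        rw [← hmap, Measure.map_map measurable_snd hff.measurable] at h
        have h' : ((π.comap (Prod.map f f)).map Prod.snd).map f = ν.map f := by
          rw [← h, Measure.map_map hf.measurable measurable_snd]
          rfl
        simpa only [hf.comap_map] using congrArg (Measure.comap f) h'
    refine (Wcost_le_lintegral hmem).trans_eq ?_
    conv_rhs => rw [← hmap, hff.lintegral_map]
    rfl

open ProbabilityTheory in
/-- Two couplings with a common marginal are the two-dimensional marginals of a common measure. -/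
lemma exists_gluing [StandardBorelSpace α] [Nonempty α] {μ ν ρ : Measure α}
    [IsProbabilityMeasure μ] [IsProbabilityMeasure ν]
    {π σ : Measure (α × α)} (hπ : π ∈ couplings μ ν) (hσ : σ ∈ couplings ν ρ) :
    ∃ Γ : Measure ((α × α) × α), Γ.map Prod.fst = π ∧ Γ.map (Prod.map Prod.snd id) = σ := by
  have := isProbabilityMeasure_of_mem_couplings hπ
  have := isProbabilityMeasure_of_mem_couplings hσ
  refine ⟨π ⊗ₘ σ.condKernel.comap Prod.snd measurable_snd, Measure.fst_compProd _ _, ?_⟩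
  have hσν : σ.fst = π.map Prod.snd := hσ.1.trans hπ.2.symm
  conv_rhs => rw [← σ.disintegrate σ.condKernel, hσν]
  have hm : Measurable (Prod.map Prod.snd id : (α × α) × α → α × α) := by fun_prop
  ext s hs
  rw [Measure.map_apply hm hs, Measure.compProd_apply (hm hs), Measure.compProd_apply hs,
    lintegral_map (Kernel.measurable_kernel_prodMk_left hs) measurable_snd]
  rfl

/-- The triangle inequality for transport costs given by the `p`-th power of a measurable
function satisfying the triangle inequality. -/
lemma Wcost_rpow_triangle [StandardBorelSpace α] [Nonempty α] {D : α × α → ℝ≥0∞}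
    (hD : Measurable D) (htri : ∀ x y z, D (x, z) ≤ D (x, y) + D (y, z)) {p : ℝ} (hp : 1 ≤ p)
    (μ ν ρ : Measure α) [IsProbabilityMeasure μ] [IsProbabilityMeasure ν] :
    Wcost (fun z => D z ^ p) μ ρ ^ (1 / p) ≤
      Wcost (fun z => D z ^ p) μ ν ^ (1 / p) + Wcost (fun z => D z ^ p) ν ρ ^ (1 / p) := by
  have hp0 : 0 < p := by linarith
  have hroot : ∀ μ ν : Measure α, Wcost (fun z => D z ^ p) μ ν ^ (1 / p) =
      ⨅ π ∈ couplings μ ν, (∫⁻ z, D z ^ p ∂π) ^ (1 / p) := fun μ ν => by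
    have := (ENNReal.orderIsoRpow (1 / p) (by positivity)).map_iInf₂
      (fun (π : Measure (α × α)) (_ : π ∈ couplings μ ν) => ∫⁻ z, D z ^ p ∂π)
    simpa only [Wcost, ENNReal.orderIsoRpow_apply] using this
  rw [hroot μ ν, hroot ν ρ]
  refine ENNReal.le_iInf₂_add_iInf₂ fun π hπ σ hσ => ?_
  obtain ⟨Γ, hΓπ, hΓσ⟩ := exists_gluing hπ hσ
  have hm : Measurable fun w : (α × α) × α => (w.1.1, w.2) := by fun_prop
  have hm' : Measurable (Prod.map Prod.snd id : (α × α) × α → α × α) := by fun_prop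
  have hmem : Γ.map (fun w => (w.1.1, w.2)) ∈ couplings μ ρ := by
    constructor
    · rw [Measure.map_map measurable_fst hm, ← hπ.1, ← hΓπ,
        Measure.map_map measurable_fst measurable_fst]
      rfl
    · rw [Measure.map_map measurable_snd hm, ← hσ.2, ← hΓσ, Measure.map_map measurable_snd hm']
      rfl
  calc Wcost (fun z => D z ^ p) μ ρ ^ (1 / p)
      ≤ (∫⁻ w, D (w.1.1, w.2) ^ p ∂Γ) ^ (1 / p) := by
        gcongr
        exact (Wcost_le_lintegral hmem).trans (lintegral_map_le _ _)
    _ ≤ (∫⁻ w, ((fun w : (α × α) × α => D w.1) +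
          fun w : (α × α) × α => D (w.1.2, w.2)) w ^ p ∂Γ) ^ (1 / p) := by
        gcongr with w
        exact htri _ _ _
    _ ≤ (∫⁻ w : (α × α) × α, D w.1 ^ p ∂Γ) ^ (1 / p) +
          (∫⁻ w, D (w.1.2, w.2) ^ p ∂Γ) ^ (1 / p) :=
        ENNReal.lintegral_Lp_add_le (hD.comp measurable_fst).aemeasurable
          (hD.comp hm').aemeasurable hp
    _ = _ := by
        rw [← hΓπ, ← hΓσ, lintegral_map (hD.pow_const p) measurable_fst,
          lintegral_map (hD.pow_const p) hm']
        rfl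

end Wcost

section Measurability

open Filter Topology TopologicalSpace ProbabilityMeasure
open scoped NNReal

lemma MeasurableEmbedding.standardBorelSpace {α β : Type*} [MeasurableSpace α]
    [MeasurableSpace β] [StandardBorelSpace β] {f : α → β} (hf : MeasurableEmbedding f) :
    StandardBorelSpace α := by
  obtain ⟨τ, hB, hP⟩ := hf.measurableSet_range.standardBorel.polish
  let : TopologicalSpace α := TopologicalSpace.induced hf.equivRange inferInstance
  refine ⟨inferInstance, ⟨?_⟩, hf.equivRange.toEquiv.polishSpace_induced⟩
  rw [borel_comap, ← hB.measurable_eq, hf.equivRange.measurableEmbedding.comap_eq]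

section Compact

variable {K : Type*} [TopologicalSpace K] [CompactSpace K] [MetrizableSpace K]
  [MeasurableSpace K] [BorelSpace K]

/-- On a compact metrizable space, the optimal cost for a lower semicontinuous cost function
depends measurably on the marginals. -/
lemma measurable_Wcost_iSup {g : ℕ → C(K × K, ℝ≥0)} (hg : Monotone g) :
    Measurable fun q : ProbabilityMeasure K × ProbabilityMeasure K =>
      Wcost (fun z => ⨆ n, (g n z : ℝ≥0∞)) (q.1 : Measure K) (q.2 : Measure K) := by
  let marg : ProbabilityMeasure (K × K) → ProbabilityMeasure K × ProbabilityMeasure K :=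
    fun π => (pushforward measurable_fst π, pushforward measurable_snd π)
  have hmarg : Continuous marg :=
    (continuous_map continuous_fst).prodMk (continuous_map continuous_snd)
  have hclosed : ∀ a : ℝ≥0∞, IsClosed {π : ProbabilityMeasure (K × K) |
      ∫⁻ z, ⨆ n, (g n z : ℝ≥0∞) ∂(π : Measure (K × K)) ≤ a} := fun a => by
    have : {π : ProbabilityMeasure (K × K) |
        ∫⁻ z, ⨆ n, (g n z : ℝ≥0∞) ∂(π : Measure (K × K)) ≤ a} =
          ⋂ n, {π : ProbabilityMeasure (K × K) | ∫⁻ z, (g n z : ℝ≥0∞) ∂(π : Measure (K × K)) ≤ a} := by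
      ext π
      simp only [mem_ofPred_eq, mem_iInter]
      rw [lintegral_iSup (f := fun n z => (g n z : ℝ≥0∞))
        (fun n => (g n).continuous.measurable.coe_nnreal_ennreal)
        (fun m n hmn z => ENNReal.coe_le_coe.2 (hg hmn z)), iSup_le_iff]
    rw [this]
    exact isClosed_iInter fun n =>
      isClosed_le (continuous_lintegral_continuousMap (g n)) continuous_const
  refine measurable_of_Iio fun r => ?_
  have hpre : (fun q : ProbabilityMeasure K × ProbabilityMeasure K =>
      Wcost (fun z => ⨆ n, (g n z : ℝ≥0∞)) (q.1 : Measure K) (q.2 : Measure K)) ⁻¹' Iio r =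
      ⋃ (a : ℚ) (_ : ENNReal.ofReal a < r), marg '' {π |
        ∫⁻ z, ⨆ n, (g n z : ℝ≥0∞) ∂(π : Measure (K × K)) ≤ ENNReal.ofReal a} := by
    ext ⟨μ, ν⟩
    simp only [mem_preimage, mem_Iio, mem_iUnion]
    constructor
    · intro h
      simp only [Wcost, iInf_lt_iff] at h
      obtain ⟨π, hπ, hlt⟩ := h
      obtain ⟨a, -, ha, har⟩ := ENNReal.lt_iff_exists_rat_btwn.1 hlt
      have hμ : IsProbabilityMeasure (μ : Measure K) := μ.2
      refine ⟨a, har, ⟨π, isProbabilityMeasure_of_mem_couplings hπ⟩, ha.le, ?_⟩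
      exact Prod.ext (Subtype.ext hπ.1) (Subtype.ext hπ.2)
    · rintro ⟨a, har, π, hπ, hq⟩
      have hπ' : (π : Measure (K × K)) ∈ couplings (μ : Measure K) ν :=
        ⟨congrArg (fun q => (q.1 : Measure K)) hq, congrArg (fun q => (q.2 : Measure K)) hq⟩
      exact ((Wcost_le_lintegral hπ').trans hπ).trans_lt har
  rw [hpre]
  exact MeasurableSet.iUnion fun a => MeasurableSet.iUnion fun _ =>
    ((hclosed _).isCompact.image hmarg).isClosed.measurableSet

end Compact

/-- A continuous function on `(ℝ≥0∞)^ℕ × (ℝ≥0∞)^ℕ`; the functions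
`truncatedCost p n` increase to `(⨆ k, u k - v k) ^ p`. -/
def truncatedCost (p : ℝ) (hp : 0 ≤ p) (n : ℕ) : C((ℕ → ℝ≥0∞) × (ℕ → ℝ≥0∞), ℝ≥0) where
  toFun w := ((Finset.range (n + 1)).sup fun k => (min (w.1 k) n - w.2 k).toNNReal) ^ p
  continuous_toFun := by
    refine (NNReal.continuous_rpow_const hp).comp (Continuous.finset_sup_apply fun k _ => ?_)
    refine continuous_iff_continuousAt.2 fun w => ?_
    have hne : min (w.1 k) (n : ℝ≥0∞) ≠ ⊤ := ne_top_of_le_ne_top (by simp) (min_le_right _ _)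
    have hsub : Tendsto (fun w : (ℕ → ℝ≥0∞) × (ℕ → ℝ≥0∞) => min (w.1 k) (n : ℝ≥0∞) - w.2 k)
        (𝓝 w) (𝓝 (min (w.1 k) n - w.2 k)) :=
      ENNReal.Tendsto.sub (Continuous.tendsto (by fun_prop) w) (Continuous.tendsto (by fun_prop) w)
        (Or.inl hne)
    exact (ENNReal.tendsto_toNNReal (ne_top_of_le_ne_top hne tsub_le_self)).comp hsub

lemma truncatedCost_mono (p : ℝ) (hp : 0 ≤ p) : Monotone (truncatedCost p hp) := by
  intro m n hmn w
  refine NNReal.rpow_le_rpow (Finset.sup_le fun k hk => ?_) hp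
  have hk' : k ∈ Finset.range (n + 1) := Finset.range_mono (by omega) hk
  refine le_trans (ENNReal.toNNReal_mono ?_ ?_)
    (Finset.le_sup (f := fun k => (min (w.1 k) n - w.2 k).toNNReal) hk')
  · exact ne_top_of_le_ne_top (ENNReal.natCast_ne_top n) (tsub_le_self.trans (min_le_right _ _))
  · gcongr

section Metric

variable {X : Type*} [MetricSpace X] [SeparableSpace X] [Nonempty X]

/-- The distances to the points of a dense sequence. -/
def distSeq (x : X) (k : ℕ) : ℝ≥0∞ := edist x (denseSeq X k)

lemma iSup_truncatedCost_distSeq {p : ℝ} (hp : 0 < p) (x y : X) :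
    ⨆ n, (truncatedCost p hp.le n (distSeq x, distSeq y) : ℝ≥0∞) = edist x y ^ p := by
  apply le_antisymm
  · refine iSup_le fun n => ?_
    have hle : (((Finset.range (n + 1)).sup
        fun k => (min (distSeq x k) n - distSeq y k).toNNReal : ℝ≥0) : ℝ≥0∞) ≤ edist x y := by
      rw [edist_nndist]
      refine ENNReal.coe_le_coe.2 (Finset.sup_le fun k _ => ?_)
      refine ENNReal.coe_le_coe.1 (ENNReal.coe_toNNReal_le_self.trans ?_)
      rw [← edist_nndist, tsub_le_iff_right]
      exact (min_le_left _ _).trans (edist_triangle _ _ _)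
    calc (truncatedCost p hp.le n (distSeq x, distSeq y) : ℝ≥0∞)
        = (((Finset.range (n + 1)).sup
            fun k => (min (distSeq x k) n - distSeq y k).toNNReal : ℝ≥0) : ℝ≥0∞) ^ p :=
          ENNReal.coe_rpow_of_nonneg _ hp.le
      _ ≤ edist x y ^ p := by gcongr
  · rw [← ENNReal.le_rpow_inv_iff hp]
    refine le_of_forall_lt_imp_le_of_dense fun r hr => ?_
    rw [ENNReal.le_rpow_inv_iff hp]
    have hopen : ∀ᶠ b in 𝓝 y, r < edist x b - edist y b := by
      have : Tendsto (fun b => edist x b - edist y b) (𝓝 y) (𝓝 (edist x y - edist y y)) :=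
        ENNReal.Tendsto.sub (Continuous.tendsto (by fun_prop) y)
          (Continuous.tendsto (by fun_prop) y) (Or.inl (edist_ne_top _ _))
      rw [edist_self, tsub_zero] at this
      exact this.eventually_const_lt hr
    obtain ⟨k, hk⟩ := (denseRange_denseSeq X).exists_mem_open isOpen_interior
      ⟨y, mem_interior_iff_mem_nhds.2 hopen⟩
    have hk' : denseSeq X k ∈ {b | r < edist x b - edist y b} := interior_subset hk
    have hkr : r < distSeq x k - distSeq y k := hk'
    obtain ⟨m, hm⟩ := ENNReal.exists_nat_gt (edist_ne_top x (denseSeq X k))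
    let n := max m k
    have hn : distSeq x k ≤ n := hm.le.trans (by simp [n])
    have hne : distSeq x k - distSeq y k ≠ ⊤ :=
      ne_top_of_le_ne_top (edist_ne_top x (denseSeq X k)) tsub_le_self
    have hkn : k ∈ Finset.range (n + 1) := by simp [n]
    refine le_iSup_of_le n ?_
    calc r ^ p ≤ (((Finset.range (n + 1)).sup
            fun k => (min (distSeq x k) n - distSeq y k).toNNReal : ℝ≥0) : ℝ≥0∞) ^ p := by
          gcongr
          refine hkr.le.trans ?_
          rw [← ENNReal.coe_toNNReal hne]
          refine ENNReal.coe_le_coe.2 ?_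
          refine le_trans ?_
            (Finset.le_sup (f := fun k => (min (distSeq x k) n - distSeq y k).toNNReal) hkn)
          rw [min_eq_left hn]
      _ = (truncatedCost p hp.le n (distSeq x, distSeq y) : ℝ≥0∞) :=
          (ENNReal.coe_rpow_of_nonneg _ hp.le).symm

variable [CompleteSpace X] [MeasurableSpace X] [BorelSpace X]

lemma measurableEmbedding_distSeq : MeasurableEmbedding (distSeq : X → ℕ → ℝ≥0∞) := by
  have : SecondCountableTopology X := UniformSpace.secondCountable_of_separable X
  refine Measurable.measurableEmbedding (measurable_pi_lambda _ fun k => ?_) fun x y hxy => ?_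
  · exact (continuous_id.edist continuous_const).measurable
  · have h := iSup_truncatedCost_distSeq one_pos x y
    rw [hxy, iSup_truncatedCost_distSeq one_pos y y] at h
    simpa using h.symm

instance standardBorelSpace_probabilityMeasure : StandardBorelSpace (ProbabilityMeasure X) :=
  (measurableEmbedding_pushforward measurableEmbedding_distSeq).standardBorelSpace

lemma measurable_Wpp {p : ℝ} (hp : 0 < p) :
    Measurable fun q : ProbabilityMeasure X × ProbabilityMeasure X =>
      Wpp p (q.1 : Measure X) (q.2 : Measure X) := by
  have hι := measurable_pushforward (measurableEmbedding_distSeq (X := X)).measurable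
  have h := (measurable_Wcost_iSup (truncatedCost_mono p hp.le)).comp
    ((hι.comp measurable_fst).prodMk (hι.comp measurable_snd))
  convert h using 2 with q
  simp only [Function.comp_apply, coe_pushforward, Wcost_map measurableEmbedding_distSeq,
    iSup_truncatedCost_distSeq hp]
  rfl

end Metric

end Measurability

section RandomMeasures

open TopologicalSpace ProbabilityMeasure

lemma measurableEmbedding_toMeasure {α : Type*} [MeasurableSpace α] :
    MeasurableEmbedding (toMeasure : ProbabilityMeasure α → Measure α) :=
  MeasurableEmbedding.subtype_coe measurableSet_isProbabilityMeasure

lemma exists_map_toMeasure_eq {α : Type*} [MeasurableSpace α] {M : Measure (Measure α)}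
    (hM : ∀ᵐ μ ∂M, IsProbabilityMeasure μ) :
    ∃ M' : Measure (ProbabilityMeasure α),
      M'.map toMeasure = M := by
  refine ⟨M.comap toMeasure, ?_⟩
  rw [measurableEmbedding_toMeasure.map_comap]
  refine Measure.restrict_eq_self_of_ae_mem ?_
  filter_upwards [hM] with μ hμ
  exact ⟨⟨μ, hμ⟩, rfl⟩

lemma Wpp_comm {α : Type*} [MeasurableSpace α] [PseudoEMetricSpace α] (p : ℝ)
    (μ ν : Measure α) : Wpp p μ ν = Wpp p ν μ :=
  Wcost_comm (fun z => congrArg (· ^ p) (edist_comm z.2 z.1)) μ ν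

lemma WWpp_comm {α : Type*} [MeasurableSpace α] [PseudoEMetricSpace α] (p : ℝ)
    (M N : Measure (Measure α)) : WWpp p M N = WWpp p N M :=
  Wcost_comm (fun q => Wpp_comm p q.2 q.1) M N

/-- A random coupling of `X`-valued maps bounds the Wasserstein-on-Wasserstein distance between
their random laws. -/
lemma WWpp_map_le {X Y : Type*} [MeasurableSpace X] [PseudoEMetricSpace X]
    [MeasurableSpace Y] {p : ℝ} {P : Measure (Measure Y)} {f g : Y → X} (hf : Measurable f) (hg : Measurable g) :
    WWpp p (P.map fun π => π.map f) (P.map fun π => π.map g) ≤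
      ∫⁻ π, ∫⁻ y, edist (f y) (g y) ^ p ∂π ∂P := by
  have hF := Measure.measurable_map f hf
  have hG := Measure.measurable_map g hg
  refine (Wcost_le_lintegral (π := P.map fun π => (π.map f, π.map g)) ⟨?_, ?_⟩).trans ?_
  · rw [Measure.map_map measurable_fst (hF.prodMk hG)]
    rfl
  · rw [Measure.map_map measurable_snd (hF.prodMk hG)]
    rfl
  refine (lintegral_map_le _ _).trans (lintegral_mono fun π => ?_)
  refine (Wcost_le_lintegral (π := π.map fun y => (f y, g y)) ⟨?_, ?_⟩).trans
    (lintegral_map_le _ _)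
  · rw [Measure.map_map measurable_fst (hf.prodMk hg)]
    rfl
  · rw [Measure.map_map measurable_snd (hf.prodMk hg)]
    rfl

variable {X : Type*} [MetricSpace X] [SeparableSpace X] [MeasurableSpace X] [BorelSpace X]

lemma lintegral_edist_rpow_le_Wpp_dirac {p : ℝ} (μ : Measure X) (x₀ : X) :
    ∫⁻ x, edist x x₀ ^ p ∂μ ≤ Wpp p μ (Measure.dirac x₀) := by
  refine le_iInf₂ fun π hπ => ?_
  have hsnd : ∀ᵐ z ∂π, z.2 = x₀ := by
    have h : ∀ᵐ y ∂π.map Prod.snd, y = x₀ := by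
      simp [hπ.2, ae_dirac_eq]
    exact ae_of_ae_map measurable_snd.aemeasurable h
  calc ∫⁻ x, edist x x₀ ^ p ∂μ = ∫⁻ x, edist x x₀ ^ p ∂(π.map Prod.fst) := by rw [hπ.1]
    _ ≤ ∫⁻ z, edist z.1 x₀ ^ p ∂π := lintegral_map_le _ _
    _ = ∫⁻ z, edist z.1 z.2 ^ p ∂π := by
      refine lintegral_congr_ae ?_
      filter_upwards [hsnd] with z hz
      rw [hz]

/-- A random coupling of two random measures with finite moments has finite cost. -/
lemma lintegral_lintegral_edist_rpow_lt_top {p : ℝ} (hp : 1 ≤ p) {x₀ : X}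
    {P : Measure (Measure (X × X))}
    (h₀ : ∫⁻ μ, Wpp p μ (Measure.dirac x₀) ∂(P.map fun π => π.map Prod.fst) < ⊤)
    (h₁ : ∫⁻ μ, Wpp p μ (Measure.dirac x₀) ∂(P.map fun π => π.map Prod.snd) < ⊤) :
    ∫⁻ π, ∫⁻ z : X × X, edist z.1 z.2 ^ p ∂π ∂P < ⊤ := by
  have hmeas : Measurable fun x : X => edist x x₀ ^ p :=
    (continuous_id.edist continuous_const).measurable.pow_const p
  have key : ∀ f : X × X → X, Measurable f →
      ∫⁻ μ, Wpp p μ (Measure.dirac x₀) ∂(P.map fun π => π.map f) < ⊤ →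
      ∫⁻ π, ∫⁻ z, edist (f z) x₀ ^ p ∂π ∂P < ⊤ := fun f hf h => by
    refine lt_of_le_of_lt ?_ h
    calc ∫⁻ π, ∫⁻ z, edist (f z) x₀ ^ p ∂π ∂P
        = ∫⁻ π, ∫⁻ x, edist x x₀ ^ p ∂(π.map f) ∂P := by
          simp only [lintegral_map hmeas hf]
      _ = ∫⁻ μ, ∫⁻ x, edist x x₀ ^ p ∂μ ∂(P.map fun π => π.map f) :=
          (lintegral_map (Measure.measurable_lintegral hmeas) (Measure.measurable_map f hf)).symm
      _ ≤ _ := lintegral_mono fun μ => lintegral_edist_rpow_le_Wpp_dirac μ x₀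
  have hmeas₀ : Measurable fun z : X × X => edist z.1 x₀ ^ p := hmeas.comp measurable_fst
  have hmeas₁ : Measurable fun z : X × X => edist z.2 x₀ ^ p := hmeas.comp measurable_snd
  have hconst : (2 : ℝ≥0∞) ^ (p - 1) < ⊤ :=
    ENNReal.rpow_lt_top_of_nonneg (by linarith) (by simp)
  calc ∫⁻ π, ∫⁻ z : X × X, edist z.1 z.2 ^ p ∂π ∂P
      ≤ ∫⁻ π, ∫⁻ z : X × X, 2 ^ (p - 1) * (edist z.1 x₀ ^ p + edist z.2 x₀ ^ p) ∂π ∂P := by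
        refine lintegral_mono fun π => lintegral_mono fun z => ?_
        refine le_trans ?_ (ENNReal.rpow_add_le_mul_rpow_add_rpow _ _ hp)
        exact ENNReal.rpow_le_rpow (edist_triangle_right _ _ _) (by linarith)
    _ = 2 ^ (p - 1) * (∫⁻ π, ∫⁻ z : X × X, edist z.1 x₀ ^ p ∂π ∂P +
          ∫⁻ π, ∫⁻ z : X × X, edist z.2 x₀ ^ p ∂π ∂P) := by
        simp only [lintegral_const_mul' _ _ hconst.ne, lintegral_add_left hmeas₀,
          lintegral_add_left (Measure.measurable_lintegral hmeas₀)]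
    _ < ⊤ := ENNReal.mul_lt_top hconst
        (ENNReal.add_lt_top.2 ⟨key _ measurable_fst h₀, key _ measurable_snd h₁⟩)

variable [CompleteSpace X]

lemma Wpp_rpow_triangle {p : ℝ} (hp : 1 ≤ p) (μ ν ρ : Measure X) [IsProbabilityMeasure μ]
    [IsProbabilityMeasure ν] :
    Wpp p μ ρ ^ (1 / p) ≤ Wpp p μ ν ^ (1 / p) + Wpp p ν ρ ^ (1 / p) := by
  have : SecondCountableTopology X := UniformSpace.secondCountable_of_separable X
  have : Nonempty X := μ.nonempty_of_neZero
  exact Wcost_rpow_triangle continuous_edist.measurable (fun x y z => edist_triangle x y z)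
    hp μ ν ρ

lemma WWpp_rpow_triangle [Nonempty X] {p : ℝ} (hp : 1 ≤ p) (M N P : Measure (ProbabilityMeasure X))
    [IsProbabilityMeasure M] [IsProbabilityMeasure N] :
    WWpp p (M.map toMeasure) (P.map toMeasure) ^ (1 / p) ≤
      WWpp p (M.map toMeasure) (N.map toMeasure) ^ (1 / p) + WWpp p (N.map toMeasure) (P.map toMeasure) ^ (1 / p) := by
  have hp0 : 0 < p := by linarith
  have : Nonempty (ProbabilityMeasure X) := M.nonempty_of_neZero
  have h := Wcost_rpow_triangle ((measurable_Wpp (X := X) hp0).pow_const (1 / p))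
    (fun μ ν ρ => Wpp_rpow_triangle hp (μ : Measure X) (ν : Measure X) (ρ : Measure X)) hp M N P
  have hroot : ∀ a : ℝ≥0∞, (a ^ (1 / p)) ^ p = a := fun a => by
    rw [one_div, ENNReal.rpow_inv_rpow hp0.ne']
  simp only [hroot] at h
  simpa only [WWpp, Wcost_map measurableEmbedding_toMeasure] using h

end RandomMeasures
/-- Let `X` be a complete separable geodesic metric space, `p > 1`,
`M₀, M₁ ∈ P_p(P_p(X))`, and let `𝔓` be an optimal random coupling: its marginals under
`π ↦ p¹_♯π`, `π ↦ p²_♯π` are `M₀`, `M₁` and `∫∫ d^p dπ d𝔓 = 𝒲_p^p(M₀,M₁)`.  Let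
`geo : [0,1] × X × X → X` be a Borel selection of constant-speed geodesics.  Then
`M_t := ((geo_t)_♯)_♯ 𝔓` is a constant-speed geodesic in `(P_p(P_p(X)), 𝒲_p)` joining
`M₀` and `M₁`. -/
theorem random_coupling_induces_geodesic
    {X : Type*} [MetricSpace X] [CompleteSpace X] [TopologicalSpace.SeparableSpace X]
    [MeasurableSpace X] [BorelSpace X]
    (p : ℝ) (hp : 1 < p)
    (M₀ M₁ : Measure (Measure X)) [IsProbabilityMeasure M₀] [IsProbabilityMeasure M₁]
    (x₀ : X)
    (hmom₀ : ∫⁻ μ, Wpp p μ (Measure.dirac x₀) ∂M₀ < ⊤)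
    (hmom₁ : ∫⁻ μ, Wpp p μ (Measure.dirac x₀) ∂M₁ < ⊤)
    (geo : ℝ → X × X → X)
    (hgeo_meas : ∀ t, Measurable (geo t))
    (hgeo₀ : ∀ z : X × X, geo 0 z = z.1) (hgeo₁ : ∀ z : X × X, geo 1 z = z.2)
    (hgeo : ∀ z : X × X, ∀ s ∈ Icc (0:ℝ) 1, ∀ t ∈ Icc (0:ℝ) 1,
      dist (geo s z) (geo t z) = |t - s| * dist z.1 z.2)
    (𝔓 : Measure (Measure (X × X))) [IsProbabilityMeasure 𝔓]
    (h𝔓prob : ∀ᵐ π ∂𝔓, IsProbabilityMeasure π)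
    (h𝔓₀ : 𝔓.map (fun π => π.map Prod.fst) = M₀)
    (h𝔓₁ : 𝔓.map (fun π => π.map Prod.snd) = M₁)
    (h𝔓opt : ∫⁻ π, (∫⁻ z : X × X, edist z.1 z.2 ^ p ∂π) ∂𝔓 = WWpp p M₀ M₁) :
    (𝔓.map (fun π => π.map (geo 0)) = M₀) ∧
    (𝔓.map (fun π => π.map (geo 1)) = M₁) ∧
    ∀ s ∈ Icc (0:ℝ) 1, ∀ t ∈ Icc (0:ℝ) 1,
      WWpp p (𝔓.map (fun π => π.map (geo s))) (𝔓.map (fun π => π.map (geo t))) =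
        ENNReal.ofReal (|t - s| ^ p) * WWpp p M₀ M₁ := by
  have hp0 : 0 < p := by linarith
  have : Nonempty X := ⟨x₀⟩
  have hgeo₀' : geo 0 = Prod.fst := funext hgeo₀
  have hgeo₁' : geo 1 = Prod.snd := funext hgeo₁
  have hM₀ : 𝔓.map (fun π => π.map (geo 0)) = M₀ := by rw [hgeo₀', h𝔓₀]
  have hM₁ : 𝔓.map (fun π => π.map (geo 1)) = M₁ := by rw [hgeo₁', h𝔓₁]
  refine ⟨hM₀, hM₁, ?_⟩
  have hfin : WWpp p M₀ M₁ < ⊤ := by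
    rw [← h𝔓opt]
    subst h𝔓₀ h𝔓₁
    exact lintegral_lintegral_edist_rpow_lt_top hp.le hmom₀ hmom₁
  have hupper : ∀ s ∈ Icc (0 : ℝ) 1, ∀ t ∈ Icc (0 : ℝ) 1,
      WWpp p (𝔓.map (fun π => π.map (geo s))) (𝔓.map (fun π => π.map (geo t))) ≤
        ENNReal.ofReal (|t - s| ^ p) * WWpp p M₀ M₁ := fun s hs t ht => by
    have hcost : ∀ z, edist (geo s z) (geo t z) ^ p =
        ENNReal.ofReal (|t - s| ^ p) * edist z.1 z.2 ^ p := fun z => by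
      rw [edist_dist, hgeo z s hs t ht, ENNReal.ofReal_mul (abs_nonneg _), ← edist_dist,
        ENNReal.mul_rpow_of_nonneg _ _ hp0.le, ENNReal.ofReal_rpow_of_nonneg (abs_nonneg _) hp0.le]
    refine (WWpp_map_le (hgeo_meas s) (hgeo_meas t)).trans_eq ?_
    simp only [hcost, lintegral_const_mul' _ _ ENNReal.ofReal_ne_top, h𝔓opt]
  have hroot : ∀ r : ℝ, 0 ≤ r → (ENNReal.ofReal (r ^ p) * WWpp p M₀ M₁) ^ (1 / p) =
      ENNReal.ofReal r * WWpp p M₀ M₁ ^ (1 / p) := fun r hr => by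
    rw [ENNReal.mul_rpow_of_nonneg _ _ (by positivity),
      ENNReal.ofReal_rpow_of_nonneg (by positivity) (by positivity), one_div,
      Real.rpow_rpow_inv hr hp0.ne']
  have htriangle : ∀ r s t : ℝ,
      WWpp p (𝔓.map (fun π => π.map (geo r))) (𝔓.map (fun π => π.map (geo t))) ^ (1 / p) ≤
        WWpp p (𝔓.map (fun π => π.map (geo r))) (𝔓.map (fun π => π.map (geo s))) ^ (1 / p) +
        WWpp p (𝔓.map (fun π => π.map (geo s))) (𝔓.map (fun π => π.map (geo t))) ^ (1 / p) := by
    obtain ⟨Q, rfl⟩ := exists_map_toMeasure_eq h𝔓prob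
    have : IsProbabilityMeasure Q := Measure.isProbabilityMeasure_of_map
      (ProbabilityMeasure.toMeasure : ProbabilityMeasure (X × X) → Measure (X × X))
    have hlift : ∀ t, (Q.map ProbabilityMeasure.toMeasure).map (fun π => π.map (geo t)) =
        (Q.map (ProbabilityMeasure.pushforward (hgeo_meas t))).map
          ProbabilityMeasure.toMeasure := fun t => by
      rw [Measure.map_map (Measure.measurable_map _ (hgeo_meas t))
          measurableEmbedding_toMeasure.measurable,
        Measure.map_map measurableEmbedding_toMeasure.measurable
          (ProbabilityMeasure.measurable_pushforward _)]
      rfl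
    have hprob : ∀ t, IsProbabilityMeasure
        (Q.map (ProbabilityMeasure.pushforward (hgeo_meas t))) := fun t =>
      Measure.isProbabilityMeasure_map (ProbabilityMeasure.measurable_pushforward _).aemeasurable
    intro r s t
    simp only [hlift]
    exact WWpp_rpow_triangle hp.le _ _ _
  have hlower : ∀ s ∈ Icc (0 : ℝ) 1, ∀ t ∈ Icc (0 : ℝ) 1, s ≤ t →
      ENNReal.ofReal (|t - s| ^ p) * WWpp p M₀ M₁ ≤
        WWpp p (𝔓.map (fun π => π.map (geo s))) (𝔓.map (fun π => π.map (geo t))) := by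
    intro s hs t ht hst
    have hle : ∀ s ∈ Icc (0 : ℝ) 1, ∀ t ∈ Icc (0 : ℝ) 1,
        WWpp p (𝔓.map (fun π => π.map (geo s))) (𝔓.map (fun π => π.map (geo t))) ^ (1 / p) ≤
          ENNReal.ofReal |t - s| * WWpp p M₀ M₁ ^ (1 / p) := fun s hs t ht =>
      (ENNReal.rpow_le_rpow (hupper s hs t ht) (by positivity)).trans_eq (hroot _ (abs_nonneg _))
    have h0 : (0 : ℝ) ∈ Icc (0 : ℝ) 1 := by simp
    have h1 : (1 : ℝ) ∈ Icc (0 : ℝ) 1 := by simp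
    have hc : WWpp p M₀ M₁ ^ (1 / p) ≠ ⊤ :=
      ENNReal.rpow_ne_top_of_nonneg (by positivity) hfin.ne
    have hchain := (htriangle 0 s 1).trans (add_le_add (hle 0 h0 s hs)
      ((htriangle s t 1).trans (add_le_add_right (hle t ht 1 h1) _)))
    rw [hM₀, hM₁] at hchain
    rw [← ENNReal.rpow_le_rpow_iff (z := 1 / p) (by positivity), hroot _ (abs_nonneg _)]
    have hd : WWpp p (𝔓.map (fun π => π.map (geo s))) (𝔓.map (fun π => π.map (geo t))) ^ (1 / p)
        ≠ ⊤ := ne_top_of_le_ne_top (ENNReal.mul_ne_top ENNReal.ofReal_ne_top hc) (hle s hs t ht)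
    rw [sub_zero, abs_of_nonneg hs.1, abs_of_nonneg (sub_nonneg.2 ht.2)] at hchain
    rw [abs_of_nonneg (sub_nonneg.2 hst)]
    generalize WWpp p (𝔓.map (fun π => π.map (geo s))) (𝔓.map (fun π => π.map (geo t))) ^ (1 / p)
      = d at hchain hd ⊢
    generalize WWpp p M₀ M₁ ^ (1 / p) = c at hchain hc ⊢
    lift c to NNReal using hc
    lift d to NNReal using hd
    have hreal := ENNReal.toReal_mono (by finiteness) hchain
    rw [ENNReal.toReal_add (by finiteness) (by finiteness),
      ENNReal.toReal_add (by finiteness) (by finiteness)] at hreal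
    simp only [ENNReal.toReal_mul, ENNReal.coe_toReal, ENNReal.toReal_ofReal hs.1,
      ENNReal.toReal_ofReal (sub_nonneg.2 ht.2)] at hreal
    refine (ENNReal.toReal_le_toReal (by finiteness) (by finiteness)).1 ?_
    simp only [ENNReal.toReal_mul, ENNReal.coe_toReal, ENNReal.toReal_ofReal (sub_nonneg.2 hst)]
    linarith
  intro s hs t ht
  refine le_antisymm (hupper s hs t ht) ?_
  rcases le_total s t with hst | hst
  · exact hlower s hs t ht hst
  · rw [abs_sub_comm, WWpp_comm p (𝔓.map _)]
    exact hlower t ht s hs hst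

end
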